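/- Let L be a smooth proper multiray in ℝ³ with countably many components. For every compact set K ⊆ ℝ³ \ L and every closed ball B ⊆ ℝ³ with K ⊆ B, there exists a continuous map F : ℝ³ × [0,1] → ℝ³ such that: F(·,0) is the identity; for each t ∈ [0,1] the map F(·,t) : ℝ³ → ℝ³ is a bijection that is C^∞ with C^∞ inverse; F(x,t) = x for all x ∈ K and all t ∈ [0,1]; F(L × {t}) ⊆ L for all t ∈ [0,1]; and F(L × {1}) ∩ B = ∅. (The ambient isotopy constructed in Remark (3) of Section 8, pushing L off the ball B while fixing K.) -/

import Mathlib

open Set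
open scoped ContDiff Topology

/-- A smooth function whose Taylor coefficients at `0` all vanish except the `n`-th, and whose
derivatives of order less than `n` are uniformly small. -/
lemma exists_contDiff_small_with_single_taylor_coeff (n : ℕ) {ε : ℝ} (hε : 0 < ε) :
    ∃ φ : ℝ → ℝ, ContDiff ℝ ∞ φ ∧ (∀ k, iteratedDeriv k φ 0 = if k = n then 1 else 0) ∧
      (∀ k < n, ∀ x, ‖iteratedDeriv k φ x‖ ≤ ε) ∧
      ∀ k, ∃ C, ∀ x, ‖iteratedDeriv k φ x‖ ≤ C := by
  let χ : ContDiffBump (0 : ℝ) := ⟨1, 2, one_pos, one_lt_two⟩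
  let ψ : ℝ → ℝ := fun y => χ y * (y ^ n / n.factorial)
  have hψ : ContDiff ℝ ∞ ψ := χ.contDiff.mul ((contDiff_id.pow n).div_const _)
  have hsupp : HasCompactSupport ψ := χ.hasCompactSupport.mul_right
  have hbound : ∀ k, ∃ C, ∀ x, ‖iteratedDeriv k ψ x‖ ≤ C := fun k => by
    simp_rw [← norm_iteratedFDeriv_eq_norm_iteratedDeriv]
    exact (hsupp.iteratedFDeriv k).exists_bound_of_continuous
      (hψ.continuous_iteratedFDeriv (by exact_mod_cast le_top))
  choose C hC using hbound
  have hzero : ∀ k, iteratedDeriv k ψ 0 = if k = n then 1 else 0 := fun k => by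
    have : ψ =ᶠ[𝓝 0] fun y => y ^ n / n.factorial := by
      filter_upwards [χ.eventuallyEq_one] with y hy
      simp [ψ, hy]
    rw [this.iteratedDeriv_eq, iteratedDeriv_div_const, iteratedDeriv_fun_pow_zero]
    have : (n.factorial : ℝ) ≠ 0 := by exact_mod_cast n.factorial_ne_zero
    split_ifs <;> simp [this]
  obtain ⟨M, hM⟩ := ((Finset.range n).image C).exists_le
  set c : ℝ := max 1 (M / ε) with hc
  have hc1 : 1 ≤ c := le_max_left _ _
  have hc0 : 0 < c := one_pos.trans_le hc1
  have hMc : M ≤ ε * c := by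
    have := le_max_right 1 (M / ε)
    rw [div_le_iff₀ hε] at this
    linarith
  have hderiv : ∀ k x, iteratedDeriv k (fun x => (c ^ n)⁻¹ * ψ (c * x)) x =
      (c ^ n)⁻¹ * (c ^ k * iteratedDeriv k ψ (c * x)) := fun k x => by
    rw [iteratedDeriv_const_mul_field,
      iteratedDeriv_comp_const_mul (hψ.of_le (by exact_mod_cast le_top))]
  refine ⟨fun x => (c ^ n)⁻¹ * ψ (c * x),
    contDiff_const.mul (hψ.comp (contDiff_const.mul contDiff_id)), fun k => ?_,
    fun k hk x => ?_, fun k => ⟨(c ^ n)⁻¹ * (c ^ k * C k), fun x => ?_⟩⟩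
  · rw [hderiv, mul_zero, hzero]
    split_ifs with h
    · subst h
      field_simp
    · simp
  · have hCM : C k ≤ ε * c := (hM _ (Finset.mem_image_of_mem C (Finset.mem_range.2 hk))).trans hMc
    rw [hderiv, norm_mul, norm_mul, norm_inv, norm_pow, norm_pow, Real.norm_of_nonneg hc0.le,
      inv_mul_le_iff₀ (by positivity)]
    calc c ^ k * ‖iteratedDeriv k ψ (c * x)‖ ≤ c ^ k * (ε * c) := by
          gcongr
          exact (hC k _).trans hCM
      _ = c ^ (k + 1) * ε := by ring
      _ ≤ c ^ n * ε := by
          gcongr ?_ * ε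
          exact pow_le_pow_right₀ hc1 hk
  · rw [hderiv, norm_mul, norm_mul, norm_inv, norm_pow, norm_pow, Real.norm_of_nonneg hc0.le]
    gcongr
    exact hC k _

/-- **Borel's lemma**: every sequence is the sequence of derivatives at `0` of some smooth
function. -/
lemma exists_contDiff_iteratedDeriv_zero_eq {E : Type*} [NormedAddCommGroup E] [NormedSpace ℝ E]
    [CompleteSpace E] (a : ℕ → E) :
    ∃ b : ℝ → E, ContDiff ℝ ∞ b ∧ ∀ k, iteratedDeriv k b 0 = a k := by
  have hpos : ∀ n, 0 < (1 / 2 : ℝ) ^ n / (1 + ‖a n‖) := fun n => by positivity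
  choose φ hφ hφ0 hφsmall C hC using
    fun n => exists_contDiff_small_with_single_taylor_coeff n (hpos n)
  have hderiv : ∀ k n x, iteratedDeriv k (fun y => φ n y • a n) x =
      iteratedDeriv k (φ n) x • a n := fun k n x =>
    iteratedDeriv_smul_const ((hφ n).of_le (by exact_mod_cast le_top)).contDiffAt _
  let v : ℕ → ℕ → ℝ := fun k n => if k < n then (1 / 2 : ℝ) ^ n else C n k * ‖a n‖
  have hf : ∀ n, ContDiff ℝ ((⊤ : ℕ∞) : WithTop ℕ∞) fun y => φ n y • a n :=
    fun n => (hφ n).smul contDiff_const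
  have hv : ∀ k : ℕ, (k : ℕ∞) ≤ ⊤ → Summable (v k) := fun k _ => by
    refine (summable_nat_add_iff (k + 1)).1 ?_
    refine ((summable_nat_add_iff (k + 1)).2 summable_geometric_two).congr fun n => ?_
    simp [v, show k < n + (k + 1) by omega]
  have hbound : ∀ (k n : ℕ) (x : ℝ), (k : ℕ∞) ≤ ⊤ →
      ‖iteratedFDeriv ℝ k (fun y => φ n y • a n) x‖ ≤ v k n := fun k n x _ => by
    rw [norm_iteratedFDeriv_eq_norm_iteratedDeriv, hderiv, norm_smul]
    simp only [v]
    split_ifs with h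
    · calc _ ≤ (1 / 2 : ℝ) ^ n / (1 + ‖a n‖) * (1 + ‖a n‖) := by
            gcongr
            · exact hφsmall n k h x
            · linarith
        _ = _ := by field_simp
    · gcongr
      exact hC n k x
  refine ⟨fun x => ∑' n, φ n x • a n, contDiff_tsum hf hv hbound, fun k => ?_⟩
  rw [iteratedDeriv_eq_equiv_comp, Function.comp_apply,
    iteratedFDeriv_tsum_apply hf hv hbound le_top]
  have := (ContinuousMultilinearMap.piFieldEquiv ℝ (Fin k) E).symm.toContinuousLinearEquiv.map_tsum
    (L := .unconditional ℕ) (f := fun n => iteratedFDeriv ℝ k (fun y => φ n y • a n) 0)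
  refine this.trans ?_
  have heq : ∀ n, (ContinuousMultilinearMap.piFieldEquiv ℝ (Fin k) E).symm.toContinuousLinearEquiv
      (iteratedFDeriv ℝ k (fun y => φ n y • a n) 0) = if n = k then a k else 0 := fun n => by
    have h := hderiv k n 0
    rw [iteratedDeriv_eq_equiv_comp, hφ0] at h
    refine h.trans ?_
    by_cases hkn : k = n
    · simp [hkn]
    · simp [hkn, Ne.symm hkn]
  simp_rw [heq]
  exact tsum_ite_eq k _

/-- A function smooth on a closed half-line extends to a smooth function on the line. -/
lemma ContDiffOn.exists_contDiff_eqOn_Ici {E : Type*} [NormedAddCommGroup E] [NormedSpace ℝ E]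
    [CompleteSpace E] {f : ℝ → E} (hf : ContDiffOn ℝ ∞ f (Ici 0)) :
    ∃ g : ℝ → E, ContDiff ℝ ∞ g ∧ EqOn g f (Ici 0) := by
  obtain ⟨b, hb, hb0⟩ := exists_contDiff_iteratedDeriv_zero_eq
    fun k => iteratedDerivWithin k f (Ici 0) 0
  let G : ℕ → ℝ → E := fun n x =>
    if 0 ≤ x then iteratedDerivWithin n f (Ici 0) x else iteratedDeriv n b x
  have hGf : ∀ n, EqOn (G n) (iteratedDerivWithin n f (Ici 0)) (Ici 0) :=
    fun n x hx => if_pos hx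
  have hGb : ∀ n, EqOn (G n) (iteratedDeriv n b) (Iic 0) := fun n x hx => by
    rcases (show x ≤ 0 from hx).eq_or_lt with rfl | hx
    · exact (hGf n self_mem_Ici).trans (hb0 n).symm
    · exact if_neg hx.not_ge
  have hf' : ∀ n, ∀ x ∈ Ici (0 : ℝ), HasDerivWithinAt (G n) (G (n + 1) x) (Ici 0) x :=
    fun n x hx => by
      rw [hGf _ hx, iteratedDerivWithin_succ]
      exact ((hf.differentiableOn_iteratedDerivWithin (by exact_mod_cast ENat.natCast_lt_top n)
        (uniqueDiffOn_Ici 0)) x hx).hasDerivWithinAt.congr (hGf n) (hGf n hx)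
  have hb' : ∀ n, ∀ x ∈ Iic (0 : ℝ), HasDerivWithinAt (G n) (G (n + 1) x) (Iic 0) x :=
    fun n x hx => by
      rw [hGb _ hx, iteratedDeriv_succ]
      exact ((hb.differentiable_iteratedDeriv n (by exact_mod_cast ENat.natCast_lt_top n))
        x).hasDerivAt.hasDerivWithinAt.congr (hGb n) (hGb n hx)
  have hG : ∀ n x, HasDerivAt (G n) (G (n + 1) x) x := fun n x => by
    rcases lt_trichotomy x 0 with hx | rfl | hx
    · exact (hb' n x hx.le).hasDerivAt (Iic_mem_nhds hx)
    · have := (hb' n 0 self_mem_Iic).union (hf' n 0 self_mem_Ici)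
      rwa [Iic_union_Ici, hasDerivWithinAt_univ] at this
    · exact (hf' n x hx.le).hasDerivAt (Ici_mem_nhds hx)
  have hiter : ∀ n, iteratedDeriv n (G 0) = G n := fun n => by
    induction n with
    | zero => simp
    | succ n ih =>
      rw [iteratedDeriv_succ, ih]
      exact funext fun x => (hG n x).deriv
  refine ⟨G 0, contDiff_of_differentiable_iteratedDeriv fun m _ => ?_, fun x hx => ?_⟩
  · rw [hiter]
    exact fun x => (hG m x).differentiableAt
  · simpa using hGf 0 hx

/-- A smooth function has a globally defined smooth local left inverse near a point where its
derivative does not vanish. -/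
lemma ContDiff.exists_contDiff_eventually_leftInverse_real {φ : ℝ → ℝ} (hφ : ContDiff ℝ ∞ φ)
    {T : ℝ} (hT : deriv φ T ≠ 0) :
    ∃ ψ : ℝ → ℝ, ContDiff ℝ ∞ ψ ∧ ∀ᶠ s in 𝓝 T, ψ (φ s) = s := by
  have hd : ∀ x, HasDerivAt φ (deriv φ x) x := fun x =>
    (hφ.differentiable (by simp) x).hasDerivAt
  have hstrict : HasStrictDerivAt φ (deriv φ T) T := hφ.hasStrictDerivAt (by simp)
  let e := (hstrict.hasStrictFDerivAt_equiv hT).toOpenPartialHomeomorph φ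
  have he : ∀ x, e x = φ x := fun x => rfl
  have hTs : T ∈ e.source := HasStrictFDerivAt.mem_toOpenPartialHomeomorph_source _
  have hTt : φ T ∈ e.target := e.map_source hTs
  have hcont : Continuous (deriv φ) := hφ.continuous_deriv (by simp)
  have hU : {y | y ∈ e.target ∧ deriv φ (e.symm y) ≠ 0} ∈ 𝓝 (φ T) := by
    refine Filter.inter_mem (e.open_target.mem_nhds hTt) ?_
    have : ContinuousAt (fun y => deriv φ (e.symm y)) (φ T) :=
      hcont.continuousAt.comp (e.continuousAt_symm hTt)
    refine this.eventually_ne ?_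
    rwa [← he T, e.left_inv hTs]
  obtain ⟨r, hr, hrU⟩ := Metric.nhds_basis_closedBall.mem_iff.1 hU
  let χ : ContDiffBump (φ T) := ⟨r / 2, r, half_pos hr, half_lt_self hr⟩
  refine ⟨fun y => χ y * e.symm y, ?_, ?_⟩
  · rw [← contMDiff_iff_contDiff]
    refine contMDiff_of_tsupport fun y hy => ?_
    have hy' : y ∈ tsupport χ := tsupport_mul_subset_left hy
    rw [χ.tsupport_eq] at hy'
    obtain ⟨hyt, hy0⟩ := hrU hy'
    exact (χ.contDiff.contDiffAt.mul
      (e.contDiffAt_symm_deriv hy0 hyt (hd _) hφ.contDiffAt)).contMDiffAt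
  · filter_upwards [e.open_source.mem_nhds hTs,
      hφ.continuous.continuousAt.eventually χ.eventuallyEq_one] with s hs h1
    rw [h1, Pi.one_apply, one_mul, ← he s, e.left_inv hs]

/-- Near a point where a smooth curve is regular, the parameter of the curve is the restriction of
a smooth function on the ambient space. -/
lemma ContDiff.exists_contDiff_eventually_leftInverse {E : Type*} [NormedAddCommGroup E]
    [NormedSpace ℝ E] {γ : ℝ → E} (hγ : ContDiff ℝ ∞ γ) {T : ℝ} (hT : deriv γ T ≠ 0) :
    ∃ τ : E → ℝ, ContDiff ℝ ∞ τ ∧ ∀ᶠ s in 𝓝 T, τ (γ s) = s := by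
  obtain ⟨ℓ, hℓ⟩ := SeparatingDual.exists_eq_one (R := ℝ) hT
  have hd : HasDerivAt (fun s => ℓ (γ s)) (ℓ (deriv γ T)) T :=
    ℓ.hasFDerivAt.comp_hasDerivAt T (hγ.differentiable (by simp) T).hasDerivAt
  obtain ⟨ψ, hψ, hψφ⟩ := (ℓ.contDiff.comp hγ).exists_contDiff_eventually_leftInverse_real
    (T := T) (by
      change deriv (fun s => ℓ (γ s)) T ≠ 0
      rw [hd.deriv, hℓ]
      exact one_ne_zero)
  exact ⟨fun x => ψ (ℓ x), hψ.comp ℓ.contDiff, hψφ⟩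

/-- A smooth map which differs from the identity by a contraction is a diffeomorphism. -/
lemma exists_contDiff_inverse_id_add {E : Type*} [NormedAddCommGroup E] [NormedSpace ℝ E]
    [CompleteSpace E] {h : E → E} (hh : ContDiff ℝ ∞ h) (hd : ∀ x, ‖fderiv ℝ h x‖ ≤ 1 / 2) :
    ∃ g : E → E, ContDiff ℝ ∞ g ∧ Function.LeftInverse g (fun x => x + h x) ∧
      Function.RightInverse g (fun x => x + h x) := by
  have hdiff : Differentiable ℝ h := hh.differentiable (by simp)
  have hlip : LipschitzWith (1 / 2) h := lipschitzWith_of_nnnorm_fderiv_le hdiff fun x => by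
    have := hd x
    rw [← NNReal.coe_le_coe]
    simpa using this
  have happrox : ApproximatesLinearOn (fun x => x + h x)
      ((ContinuousLinearEquiv.refl ℝ E : E ≃L[ℝ] E) : E →L[ℝ] E) univ (1 / 2) := by
    intro x _ y _
    have := hlip.dist_le_mul x y
    rw [dist_eq_norm, dist_eq_norm] at this
    have heq : x + h x - (y + h y) - (x - y) = h x - h y := by abel
    simpa [heq] using this
  have hc : Subsingleton E ∨ (1 / 2 : NNReal) <
      ‖((ContinuousLinearEquiv.refl ℝ E).symm : E →L[ℝ] E)‖₊⁻¹ := by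
    rcases subsingleton_or_nontrivial E with hE | hE
    · exact Or.inl hE
    · right
      have : ‖((ContinuousLinearEquiv.refl ℝ E).symm : E →L[ℝ] E)‖₊ = 1 := by
        simp
      rw [this, inv_one]
      exact NNReal.half_lt_self one_ne_zero
  let e := happrox.toHomeomorph (fun x => x + h x) hc
  have hnorm : ∀ x, ‖-fderiv ℝ h x‖ < 1 := fun x => by
    rw [norm_neg]
    exact (hd x).trans_lt (by norm_num)
  refine ⟨e.symm, e.contDiff_symm (f₀' := fun x =>
    ContinuousLinearEquiv.unitsEquiv ℝ E (Units.oneSub (-fderiv ℝ h x) (hnorm x)))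
    (fun x => ?_) (contDiff_id.add hh), e.left_inv, e.right_inv⟩
  have hunit : (ContinuousLinearEquiv.unitsEquiv ℝ E
      (Units.oneSub (-fderiv ℝ h x) (hnorm x)) : E →L[ℝ] E) =
      ContinuousLinearMap.id ℝ E + fderiv ℝ h x := by
    ext v
    simp
  rw [hunit]
  exact (hasFDerivAt_id x).add (hdiff x).hasFDerivAt

/-- A smooth compactly supported deformation of the identity consists of diffeomorphisms for small
parameters. -/
lemma eventually_exists_contDiff_inverse_id_add {E : Type*} [NormedAddCommGroup E]
    [NormedSpace ℝ E] [CompleteSpace E] {H : ℝ × E → E} (hH : ContDiff ℝ ∞ H) {C : Set E}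
    (hC : IsCompact C) (hsupp : ∀ s, ∀ x ∉ C, H (s, x) = 0) (hzero : ∀ x, H (0, x) = 0) :
    ∀ᶠ s in 𝓝 (0 : ℝ), ∃ g : E → E, ContDiff ℝ ∞ g ∧
      Function.LeftInverse g (fun x => x + H (s, x)) ∧
      Function.RightInverse g (fun x => x + H (s, x)) := by
  have hslice : ∀ s, ContDiff ℝ ∞ fun x => H (s, x) := fun s =>
    hH.comp (contDiff_const.prodMk contDiff_id)
  let D : ℝ → E → E →L[ℝ] E := fun s x => fderiv ℝ (fun y => H (s, y)) x
  have hD : ∀ s x, D s x = (fderiv ℝ H (s, x)).comp (ContinuousLinearMap.inr ℝ ℝ E) :=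
    fun s x => (((hH.differentiable (by simp)) (s, x)).hasFDerivAt.comp x
      (hasFDerivAt_prodMk_right s x)).fderiv
  have hDcont : Continuous fun p : ℝ × E => ‖D p.1 p.2‖ := by
    simp_rw [hD]
    exact ((hH.continuous_fderiv (by simp)).clm_comp continuous_const).norm
  have hev : ∀ᶠ s in 𝓝 (0 : ℝ), ∀ x ∈ C, ‖D s x‖ < 1 / 2 := by
    refine hC.eventually_forall_of_forall_eventually fun x _ => ?_
    refine hDcont.continuousAt.eventually_lt continuousAt_const ?_
    simp [D, hzero]
  filter_upwards [hev] with s hs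
  refine exists_contDiff_inverse_id_add (hslice s) fun x => ?_
  by_cases hx : x ∈ C
  · exact (hs x hx).le
  · have : (fun y => H (s, y)) =ᶠ[𝓝 x] fun _ => 0 := by
      filter_upwards [hC.isClosed.isOpen_compl.mem_nhds hx] with y hy using hsupp s y hy
    rw [this.fderiv_eq]
    simp

/-- An isotopy of diffeomorphisms, starting at the identity and fixing `K` pointwise, which moves
every point of each of the rays `ρ i` forward along this ray. -/
structure IsForwardIsotopy {ι E : Type*} [NormedAddCommGroup E] [NormedSpace ℝ E]
    (ρ : ι → ℝ → E) (K : Set E) (F : E × ℝ → E) : Prop where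
  continuous : Continuous F
  map_zero : ∀ x, F (x, 0) = x
  contDiff : ∀ t ∈ Icc (0 : ℝ) 1, ContDiff ℝ ∞ fun x => F (x, t)
  exists_inverse : ∀ t ∈ Icc (0 : ℝ) 1, ∃ g : E → E, ContDiff ℝ ∞ g ∧
    Function.LeftInverse g (fun x => F (x, t)) ∧ Function.RightInverse g (fun x => F (x, t))
  fixes : ∀ x ∈ K, ∀ t ∈ Icc (0 : ℝ) 1, F (x, t) = x
  forward : ∀ i, ∀ s ≥ 0, ∀ t ∈ Icc (0 : ℝ) 1, ∃ s' ≥ s, F (ρ i s, t) = ρ i s'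

namespace IsForwardIsotopy

variable {ι E : Type*} [NormedAddCommGroup E] [NormedSpace ℝ E] {ρ : ι → ℝ → E} {K : Set E}

lemma refl : IsForwardIsotopy ρ K Prod.fst where
  continuous := continuous_fst
  map_zero _ := rfl
  contDiff _ _ := contDiff_id
  exists_inverse _ _ := ⟨id, contDiff_id, fun _ => rfl, fun _ => rfl⟩
  fixes _ _ _ _ := rfl
  forward _ s _ _ _ := ⟨s, le_rfl, rfl⟩

lemma comp {F G : E × ℝ → E} (hG : IsForwardIsotopy ρ K G) (hF : IsForwardIsotopy ρ K F) :
    IsForwardIsotopy ρ K fun p => G (F p, p.2) where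
  continuous := hG.continuous.comp (hF.continuous.prodMk continuous_snd)
  map_zero x := by simp [hF.map_zero, hG.map_zero]
  contDiff t ht := (hG.contDiff t ht).comp (hF.contDiff t ht)
  exists_inverse t ht := by
    obtain ⟨f, hf, hfl, hfr⟩ := hF.exists_inverse t ht
    obtain ⟨g, hg, hgl, hgr⟩ := hG.exists_inverse t ht
    exact ⟨f ∘ g, hf.comp hg, hgl.comp hfl, hgr.comp hfr⟩
  fixes x hx t ht := by simp [hF.fixes x hx t ht, hG.fixes x hx t ht]
  forward i s hs t ht := by
    obtain ⟨s', hs', h⟩ := hF.forward i s hs t ht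
    obtain ⟨s'', hs'', h'⟩ := hG.forward i s' (hs.le.trans hs') t ht
    exact ⟨s'', hs'.le.trans hs'', by simp [h, h']⟩

/-- If every point of a ray can be pushed a little past itself, then the whole ray can be pushed
past any of its points. -/
lemma exists_push {i : ι}
    (hlocal : ∀ T ≥ 0, ∃ ε > 0, ∃ F, IsForwardIsotopy ρ K F ∧
      ∀ s ≥ 0, T - ε ≤ s → ∃ s' ≥ T + ε, F (ρ i s, 1) = ρ i s')
    (T : ℝ) : ∃ F, IsForwardIsotopy ρ K F ∧ ∀ s ≥ 0, ∃ s' ≥ T, F (ρ i s, 1) = ρ i s' := by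
  let S : Set ℝ :=
    {T | ∃ F, IsForwardIsotopy ρ K F ∧ ∀ s ≥ 0, ∃ s' ≥ T, F (ρ i s, 1) = ρ i s'}
  have h0 : (0 : ℝ) ∈ S := ⟨_, refl, fun s hs => ⟨s, hs, rfl⟩⟩
  change T ∈ S
  by_contra hT
  have hlower : ∀ x ∈ S, ∀ y ≤ x, y ∈ S := fun x ⟨F, hF, hx⟩ y hy =>
    ⟨F, hF, fun s hs => (hx s hs).imp fun _ h => ⟨hy.trans h.1, h.2⟩⟩
  have hbdd : BddAbove S := ⟨T, fun x hx => le_of_not_ge fun h => hT (hlower x hx T h)⟩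
  have hsup : 0 ≤ sSup S := le_csSup hbdd h0
  obtain ⟨ε, hε, G, hG, hpush⟩ := hlocal (sSup S) hsup
  obtain ⟨x, hx, hxs⟩ := exists_lt_of_lt_csSup ⟨0, h0⟩ (sub_lt_self (sSup S) hε)
  obtain ⟨F, hF, hFx⟩ := hlower _ (show max x 0 ∈ S by rcases max_choice x 0 with h | h <;> rwa [h])
    _ le_rfl
  have : sSup S + ε ∈ S := ⟨_, hG.comp hF, fun s hs => by
    obtain ⟨s', hs', h⟩ := hFx s hs
    obtain ⟨s'', hs'', h'⟩ :=
      hpush s' ((le_max_right _ _).trans hs') (hxs.le.trans ((le_max_left _ _).trans hs'))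
    exact ⟨s'', hs'', by simp [h, h']⟩⟩
  have := le_csSup hbdd this
  linarith

lemma exists_push_finite {I : Set ι} (hI : I.Finite) {T : ι → ℝ} (hT : ∀ i, 0 ≤ T i)
    (hpush : ∀ i ∈ I, ∃ F, IsForwardIsotopy ρ K F ∧
      ∀ s ≥ 0, ∃ s' ≥ T i, F (ρ i s, 1) = ρ i s') :
    ∃ F, IsForwardIsotopy ρ K F ∧
      ∀ i ∈ I, ∀ s ≥ 0, ∃ s' ≥ T i, F (ρ i s, 1) = ρ i s' := by
  induction I, hI using Set.Finite.induction_on with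
  | empty => exact ⟨_, refl, by simp⟩
  | @insert a I _ _ ih =>
    obtain ⟨F, hF, hFI⟩ := ih fun i hi => hpush i (mem_insert_of_mem _ hi)
    obtain ⟨G, hG, hGa⟩ := hpush a (mem_insert _ _)
    refine ⟨_, hG.comp hF, ?_⟩
    rintro i (rfl | hi) s hs
    · obtain ⟨s', hs', h⟩ := hF.forward i s hs 1 (right_mem_Icc.2 zero_le_one)
      obtain ⟨s'', hs'', h'⟩ := hGa s' (hs.le.trans hs')
      exact ⟨s'', hs'', by simp [h, h']⟩
    · obtain ⟨s', hs', h⟩ := hFI i hi s hs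
      obtain ⟨s'', hs'', h'⟩ := hG.forward i s' ((hT i).trans hs') 1 (right_mem_Icc.2 zero_le_one)
      exact ⟨s'', hs'.le.trans hs'', by simp [h, h']⟩

end IsForwardIsotopy

section Multiray

variable {ι E : Type*} [NormedAddCommGroup E] [NormedSpace ℝ E] [FiniteDimensional ℝ E]
  {ρ : ι → ℝ → E}

/-- A point of a proper multiray has a neighbourhood which meets the multiray only in a short piece
of the ray through this point. -/
lemma eventually_multiray_parameter_near (h_inj : ∀ i, InjOn (ρ i) (Ici 0))
    (h_proper : ∀ i, IsProperMap fun t : Ici (0 : ℝ) => ρ i t)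
    (h_disj : Pairwise fun i j => Disjoint (ρ i '' Ici 0) (ρ j '' Ici 0))
    (h_locfin : ∀ K : Set E, IsCompact K → {i : ι | ((ρ i '' Ici 0) ∩ K).Nonempty}.Finite)
    {i : ι} {T δ : ℝ} (hT : 0 ≤ T) (hδ : 0 < δ) :
    ∀ᶠ x in 𝓝 (ρ i T), ∀ j, ∀ s ≥ 0, ρ j s = x → j = i ∧ |s - T| < δ := by
  have hfin := h_locfin _ (isCompact_closedBall (ρ i T) 1)
  have hothers : ∀ᶠ x in 𝓝 (ρ i T),
      ∀ j ∈ {j | ((ρ j '' Ici 0) ∩ Metric.closedBall (ρ i T) 1).Nonempty},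
        j ≠ i → x ∉ ρ j '' Ici 0 := by
    rw [Filter.eventually_all_finite hfin]
    intro j _
    by_cases hji : j = i
    · exact .of_forall fun _ h => absurd hji h
    · have hclosed : IsClosed (ρ j '' Ici 0) := by
        have := (h_proper j).isClosedMap.isClosed_range
        rwa [show (fun t : Ici (0 : ℝ) => ρ j t) = ρ j ∘ Subtype.val from rfl, range_comp,
          Subtype.range_coe] at this
      have hnot : ρ i T ∉ ρ j '' Ici 0 := fun h =>
        (h_disj hji).le_bot ⟨h, mem_image_of_mem _ hT⟩
      filter_upwards [hclosed.isOpen_compl.mem_nhds hnot] with x hx _ using hx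
  have hsame : ∀ᶠ x in 𝓝 (ρ i T), x ∉ (fun t : Ici (0 : ℝ) => ρ i t) '' {t | δ ≤ |(t : ℝ) - T|} := by
    refine ((h_proper i).isClosedMap _ (isClosed_le continuous_const
      (by fun_prop))).isOpen_compl.mem_nhds ?_
    rintro ⟨⟨t, ht⟩, htδ, h⟩
    obtain rfl : t = T := h_inj i ht hT h
    simp only [mem_ofPred_eq, sub_self, abs_zero] at htδ
    exact htδ.not_gt hδ
  filter_upwards [hothers, hsame, Metric.closedBall_mem_nhds _ one_pos] with x hx hxi hxB j s hs h
  obtain rfl : j = i := by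
    by_contra hji
    exact hx j ⟨x, ⟨s, hs, h⟩, hxB⟩ hji ⟨s, hs, h⟩
  exact ⟨rfl, lt_of_not_ge fun hle => hxi ⟨⟨s, hs⟩, hle, h⟩⟩

/-- Near each of its points, a smooth proper multiray can be pushed forward along itself by an
isotopy supported away from a given closed set disjoint from the multiray. -/
lemma exists_local_push (h_inj : ∀ i, InjOn (ρ i) (Ici 0))
    (h_smooth : ∀ i, ContDiffOn ℝ ∞ (ρ i) (Ici 0))
    (h_deriv : ∀ i, ∀ t ∈ Ici (0 : ℝ), derivWithin (ρ i) (Ici 0) t ≠ 0)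
    (h_proper : ∀ i, IsProperMap fun t : Ici (0 : ℝ) => ρ i t)
    (h_disj : Pairwise fun i j => Disjoint (ρ i '' Ici 0) (ρ j '' Ici 0))
    (h_locfin : ∀ K : Set E, IsCompact K → {i : ι | ((ρ i '' Ici 0) ∩ K).Nonempty}.Finite)
    {K : Set E} (hK : IsClosed K) (hKL : K ⊆ (⋃ i, ρ i '' Ici 0)ᶜ) (i : ι) {T : ℝ} (hT : 0 ≤ T) :
    ∃ ε > 0, ∃ F, IsForwardIsotopy ρ K F ∧
      ∀ s ≥ 0, T - ε ≤ s → ∃ s' ≥ T + ε, F (ρ i s, 1) = ρ i s' := by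
  have : CompleteSpace E := FiniteDimensional.complete ℝ E
  obtain ⟨γ, hγ, hγρ⟩ := (h_smooth i).exists_contDiff_eqOn_Ici
  have hγd : deriv γ T ≠ 0 := by
    have h := h_deriv i T hT
    rwa [← derivWithin_congr hγρ (hγρ hT),
      (hγ.differentiable (by simp) T).derivWithin (uniqueDiffOn_Ici 0 T hT)] at h
  obtain ⟨τ, hτ, hτγ⟩ := hγ.exists_contDiff_eventually_leftInverse hγd
  obtain ⟨δ, hδ, hδτ⟩ := Metric.eventually_nhds_iff.1 hτγ
  have hTK : ρ i T ∉ K := fun h => hKL h (mem_iUnion.2 ⟨i, mem_image_of_mem _ hT⟩)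
  obtain ⟨r, hr, hrU⟩ := Metric.nhds_basis_closedBall.mem_iff.1
    (Filter.inter_mem (hK.isOpen_compl.mem_nhds hTK)
      (eventually_multiray_parameter_near h_inj h_proper h_disj h_locfin (i := i) hT hδ))
  let β : ContDiffBump (ρ i T) := ⟨r / 2, r, half_pos hr, half_lt_self hr⟩
  have hβ : ∀ x ∉ Metric.closedBall (ρ i T) r, β x = 0 := fun x hx =>
    β.zero_of_le_dist (le_of_not_ge hx)
  let H : ℝ × E → E := fun p => γ (τ p.2 + p.1 * β p.2) - γ (τ p.2)
  have hHβ : ∀ s x, β x = 0 → H (s, x) = 0 := fun s x hx => by simp [H, hx]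
  have hH : ContDiff ℝ ∞ H := by
    have hτ' : ContDiff ℝ ∞ fun p : ℝ × E => τ p.2 := hτ.comp contDiff_snd
    have hβ' : ContDiff ℝ ∞ fun p : ℝ × E => β p.2 := β.contDiff.comp contDiff_snd
    exact (hγ.comp (hτ'.add (contDiff_fst.mul hβ'))).sub (hγ.comp hτ')
  obtain ⟨η₀, hη₀, hdiffeo⟩ := Metric.eventually_nhds_iff.1
    (eventually_exists_contDiff_inverse_id_add hH (isCompact_closedBall (ρ i T) r)
      (fun s x hx => hHβ s x (hβ x hx)) (fun x => by simp [H]))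
  let η := η₀ / 2
  have hη : 0 < η := half_pos hη₀
  have hmove : ∀ j, ∀ s ≥ 0, ∀ t ≥ 0, ρ j s + H (t, ρ j s) = ρ j (s + t * β (ρ j s)) := by
    intro j s hs t ht
    by_cases hx : ρ j s ∈ Metric.closedBall (ρ i T) r
    · obtain ⟨rfl, hsT⟩ := (hrU hx).2 j s hs rfl
      have hs' : 0 ≤ s + t * β (ρ j s) := add_nonneg hs (mul_nonneg ht β.nonneg)
      have hτs : τ (ρ j s) = s := by
        rw [← hγρ hs]
        exact hδτ hsT
      simp only [H, hτs]
      rw [hγρ hs, hγρ hs']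
      abel
    · simp [hHβ _ _ (hβ _ hx), hβ _ hx]
  obtain ⟨δ', hδ', hβ1⟩ : ∃ δ' > 0, ∀ s ≥ 0, |s - T| < δ' → β (ρ i s) = 1 := by
    have : ∀ᶠ s in 𝓝[Ici 0] T, β (ρ i s) = 1 :=
      ((h_smooth i).continuousOn T hT).eventually β.eventuallyEq_one
    obtain ⟨δ', hδ', h⟩ := Metric.mem_nhdsWithin_iff.1 this
    exact ⟨δ', hδ', fun s hs hsT => h ⟨hsT, hs⟩⟩
  refine ⟨min (η / 2) (δ' / 2), by positivity, fun p => p.1 + H (p.2 * η, p.1), ?_, ?_⟩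
  · exact {
      continuous := continuous_fst.add (hH.continuous.comp
        ((continuous_snd.mul continuous_const).prodMk continuous_fst))
      map_zero := fun x => by simp [H]
      contDiff := fun t _ =>
        contDiff_id.add (hH.comp (contDiff_const (c := t * η) |>.prodMk contDiff_id))
      exists_inverse := fun t ht => hdiffeo (by
        rw [dist_zero_right, Real.norm_of_nonneg (mul_nonneg ht.1 hη.le)]
        calc t * η ≤ 1 * η := by gcongr; exact ht.2
          _ = η₀ / 2 := one_mul _
          _ < η₀ := half_lt_self hη₀)
      fixes := fun x hx t _ => by
        have : x ∉ Metric.closedBall (ρ i T) r := fun h => (hrU h).1 hx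
        simp [hHβ _ _ (hβ x this)]
      forward := fun j s hs t ht => by
        have htη : 0 ≤ t * η := mul_nonneg ht.1 hη.le
        exact ⟨_, le_add_of_nonneg_right (mul_nonneg htη β.nonneg), hmove j s hs _ htη⟩ }
  · intro s hs hsT
    refine ⟨_, ?_, hmove i s hs (1 * η) (by linarith)⟩
    have h1 := min_le_left (η / 2) (δ' / 2)
    have h2 := min_le_right (η / 2) (δ' / 2)
    have h3 : 0 < min (η / 2) (δ' / 2) := by positivity
    rcases le_total (T + min (η / 2) (δ' / 2)) s with h | h
    · exact le_add_of_le_of_nonneg h (mul_nonneg (by linarith) β.nonneg)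
    · rw [hβ1 s hs (by rw [abs_lt]; constructor <;> linarith)]
      linarith

end Multiray

/-- Given a smooth proper multiray `L ⊆ ℝ³` with countably many components, a compact
`K ⊆ ℝ³ \ L`, and a closed ball `B ⊇ K`, there is an ambient isotopy of ℝ³ fixing `K`,
preserving `L` at each time, and pushing `L` off the ball `B` at time `1`. -/
theorem exists_ambient_isotopy_pushing_multiray_off_ball
    (ι : Type*) [Countable ι] (ρ : ι → ℝ → EuclideanSpace ℝ (Fin 3))
    (h_inj : ∀ i, Set.InjOn (ρ i) (Set.Ici 0))
    (h_smooth : ∀ i, ContDiffOn ℝ (⊤ : ℕ∞) (ρ i) (Set.Ici 0))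
    (h_deriv : ∀ i, ∀ t ∈ Set.Ici (0 : ℝ), derivWithin (ρ i) (Set.Ici 0) t ≠ 0)
    (h_proper : ∀ i, IsProperMap fun t : Set.Ici (0 : ℝ) => ρ i (t : ℝ))
    (h_disj : Pairwise fun i j => Disjoint (ρ i '' Set.Ici 0) (ρ j '' Set.Ici 0))
    (h_locfin : ∀ K : Set (EuclideanSpace ℝ (Fin 3)), IsCompact K →
      {i : ι | ((ρ i '' Set.Ici 0) ∩ K).Nonempty}.Finite)
    (K : Set (EuclideanSpace ℝ (Fin 3))) (hK : IsCompact K)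
    (hKL : K ⊆ (⋃ i, ρ i '' Set.Ici 0)ᶜ)
    (c : EuclideanSpace ℝ (Fin 3)) (rad : ℝ) (hKB : K ⊆ Metric.closedBall c rad) :
    ∃ F : EuclideanSpace ℝ (Fin 3) × ℝ → EuclideanSpace ℝ (Fin 3),
      ContinuousOn F (Set.univ ×ˢ Set.Icc 0 1) ∧
      (∀ x, F (x, 0) = x) ∧
      (∀ t ∈ Set.Icc (0 : ℝ) 1,
        Function.Bijective (fun x => F (x, t)) ∧
        ContDiff ℝ (⊤ : ℕ∞) (fun x => F (x, t)) ∧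
        ContDiff ℝ (⊤ : ℕ∞) (Function.invFun fun x => F (x, t))) ∧
      (∀ x ∈ K, ∀ t ∈ Set.Icc (0 : ℝ) 1, F (x, t) = x) ∧
      (∀ t ∈ Set.Icc (0 : ℝ) 1,
        (fun x => F (x, t)) '' (⋃ i, ρ i '' Set.Ici 0) ⊆ ⋃ i, ρ i '' Set.Ici 0) ∧
      ((fun x => F (x, 1)) '' (⋃ i, ρ i '' Set.Ici 0)) ∩ Metric.closedBall c rad = ∅ := by
  obtain ⟨T, hT0, hT⟩ : ∃ T : ι → ℝ, (∀ i, 0 ≤ T i) ∧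
      ∀ i, ∀ s ≥ T i, ρ i s ∉ Metric.closedBall c rad := by
    have : ∀ i, ∃ T : ℝ, 0 ≤ T ∧ ∀ s ≥ T, ρ i s ∉ Metric.closedBall c rad := fun i => by
      have hcomp := (h_proper i).isCompact_preimage (isCompact_closedBall c rad)
      obtain ⟨M, hM⟩ := (hcomp.image continuous_subtype_val).bddAbove
      refine ⟨max 0 (M + 1), le_max_left _ _, fun s hs h => ?_⟩
      have hs0 : 0 ≤ s := (le_max_left _ _).trans hs
      have := hM ⟨⟨s, hs0⟩, h, rfl⟩
      linarith [(le_max_right _ _).trans hs]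
    choose T hT using this
    exact ⟨T, fun i => (hT i).1, fun i => (hT i).2⟩
  obtain ⟨F, hF, hFpush⟩ := IsForwardIsotopy.exists_push_finite
    (h_locfin _ (isCompact_closedBall c rad)) hT0 fun i _ =>
      IsForwardIsotopy.exists_push (fun S hS => exists_local_push h_inj h_smooth h_deriv h_proper
        h_disj h_locfin hK.isClosed hKL i hS) (T i)
  refine ⟨F, hF.continuous.continuousOn, hF.map_zero, fun t ht => ?_, hF.fixes, ?_, ?_⟩
  · obtain ⟨g, hg, hgl, hgr⟩ := hF.exists_inverse t ht
    refine ⟨⟨hgl.injective, hgr.surjective⟩, hF.contDiff t ht, ?_⟩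
    have hinv : Function.invFun (fun x => F (x, t)) = g := funext fun y =>
      hgl.injective ((Function.rightInverse_invFun hgr.surjective y).trans (hgr y).symm)
    rwa [hinv]
  · rintro t ht _ ⟨x, hx, rfl⟩
    obtain ⟨i, s, hs, rfl⟩ := mem_iUnion.1 hx
    obtain ⟨s', hs', h⟩ := hF.forward i s hs t ht
    exact mem_iUnion.2 ⟨i, s', le_trans hs hs', h.symm⟩
  · rw [eq_empty_iff_forall_notMem]
    rintro _ ⟨⟨x, hx, rfl⟩, hB⟩
    obtain ⟨i, s, hs, rfl⟩ := mem_iUnion.1 hx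
    by_cases hi : ((ρ i '' Ici 0) ∩ Metric.closedBall c rad).Nonempty
    · obtain ⟨s', hs', h⟩ := hFpush i hi s hs
      exact hT i s' hs' (h ▸ hB)
    · obtain ⟨s', hs', h⟩ := hF.forward i s hs 1 (right_mem_Icc.2 zero_le_one)
      exact hi ⟨_, ⟨s', le_trans hs hs', h.symm⟩, hB⟩
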